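/- In the Gibbs setting on ℝ^n, take F ∈ C_c^∞(ℝ^n) and Z ∈ C¹(ℝ^n) ∩ L¹(P), and set X := L F + Z. Let σ > 0 and let N be a standard real Gaussian. Then TV(X, σN) ≤ (2/σ²) E[|σ² − Γ[X, −F]|] + (1/σ)√(π/2) E[|Z|], where Γ[X, −F] = −∇X·∇F. -/

import Mathlib

open MeasureTheory ProbabilityTheory Real Filter
open scoped ENNReal NNReal BigOperators Topology

noncomputable section

/-- Partial derivative `∂_i F` of a function on `ℝⁿ`. -/
def pd {n : ℕ} (i : Fin n) (F : (Fin n → ℝ) → ℝ) (x : Fin n → ℝ) : ℝ :=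
  deriv (fun t => F (Function.update x i t)) (x i)

/-- Carré du champ `Γ[F,G] = ∇F · ∇G`. -/
def cdc {n : ℕ} (F G : (Fin n → ℝ) → ℝ) (x : Fin n → ℝ) : ℝ :=
  ∑ i, pd i F x * pd i G x

/-- The diffusive Markov generator `L F = ΔF − ∇W·∇F`. -/
def genL {n : ℕ} (W F : (Fin n → ℝ) → ℝ) (x : Fin n → ℝ) : ℝ :=
  (∑ i, pd i (pd i F) x) - cdc W F x

/-- Normalizing constant `Z₀ = ∫ e^{-W}`. -/
def gibbsZ {n : ℕ} (W : (Fin n → ℝ) → ℝ) : ℝ :=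
  ∫ x : Fin n → ℝ, Real.exp (-W x)

/-- The Gibbs probability measure `P = Z₀⁻¹ e^{-W(x)} dx` on `ℝⁿ`. -/
def gibbsP {n : ℕ} (W : (Fin n → ℝ) → ℝ) : Measure (Fin n → ℝ) :=
  volume.withDensity fun x => ENNReal.ofReal (Real.exp (-W x) / gibbsZ W)

/-- Standard Gaussian measure on `ℝ^d` (with the Euclidean norm). -/
def stdGaussianE (d : ℕ) : Measure (EuclideanSpace ℝ (Fin d)) :=
  (Measure.pi fun _ : Fin d => gaussianReal 0 1).map (EuclideanSpace.equiv (Fin d) ℝ).symm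

/-- `p`-Wasserstein distance between two laws. -/
def wassersteinDist {E : Type*} [MeasurableSpace E] [NormedAddCommGroup E]
    (p : ℝ) (μ ν : Measure E) : ℝ :=
  sInf {r | ∃ cpl : Measure (E × E), IsProbabilityMeasure cpl ∧
    cpl.map Prod.fst = μ ∧ cpl.map Prod.snd = ν ∧ r = (∫ z, ‖z.1 - z.2‖ ^ p ∂cpl) ^ (1 / p)}

/-- Total variation distance between two laws on `ℝ`. -/
def tvDist (μ ν : Measure ℝ) : ℝ :=
  sSup {r | ∃ B : Set ℝ, MeasurableSet B ∧ r = (μ B).toReal - (ν B).toReal}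

/-- Frobenius (Hilbert–Schmidt) norm of a matrix. -/
def frobeniusNorm {d : ℕ} (A : Matrix (Fin d) (Fin d) ℝ) : ℝ :=
  Real.sqrt (∑ i, ∑ j, A i j ^ 2)

/-- Operator norm of a matrix acting on Euclidean space. -/
def matOpNorm {d : ℕ} (A : Matrix (Fin d) (Fin d) ℝ) : ℝ :=
  ‖Matrix.toEuclideanCLM (𝕜 := ℝ) A‖

/-- A smooth compactly supported function on `ℝⁿ`. -/
def IsCcInfty {n : ℕ} (F : (Fin n → ℝ) → ℝ) : Prop :=
  ContDiff ℝ (⊤ : ℕ∞) F ∧ HasCompactSupport F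

lemma integrable_exp_neg_half_sq : Integrable fun y : ℝ => exp (-(1 / 2) * y ^ 2) :=
  integrable_exp_neg_mul_sq (by norm_num)

lemma integral_Ioi_exp_neg_half_sq_le {x : ℝ} (hx : 0 ≤ x) :
    ∫ y in Set.Ioi x, exp (-(1 / 2) * y ^ 2) ≤ exp (-(1 / 2) * x ^ 2) * √(π / 2) := by
  have h0 : ∫ y in Set.Ioi (0 : ℝ), exp (-(1 / 2) * y ^ 2) = √(π / 2) := by
    rw [integral_gaussian_Ioi, div_eq_iff two_ne_zero]
    have : π / (1 / 2) = π / 2 * 2 ^ 2 := by ring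
    rw [this, Real.sqrt_mul (by positivity), Real.sqrt_sq zero_le_two]
  have hshift : ∫ y in Set.Ioi x, exp (-(1 / 2) * y ^ 2)
      = ∫ t in Set.Ioi (0 : ℝ), exp (-(1 / 2) * (t + x) ^ 2) := by
    rw [← integral_indicator measurableSet_Ioi, ← integral_indicator measurableSet_Ioi,
      ← integral_add_right_eq_self _ x]
    congr 1 with t
    simp [Set.indicator]
  rw [hshift, ← h0, ← integral_const_mul]
  refine setIntegral_mono_on ?_ ?_ measurableSet_Ioi fun t ht => ?_
  · exact (integrable_exp_neg_half_sq.comp_add_right x).integrableOn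
  · exact (integrable_exp_neg_half_sq.const_mul _).integrableOn
  · rw [← exp_add]
    have : 0 < t := ht
    gcongr
    nlinarith [mul_nonneg this.le hx]

lemma mul_integral_Ioi_exp_neg_half_sq_le (x : ℝ) :
    x * ∫ y in Set.Ioi x, exp (-(1 / 2) * y ^ 2) ≤ exp (-(1 / 2) * x ^ 2) := by
  have hint : Integrable fun y : ℝ => y * exp (-(1 / 2) * y ^ 2) :=
    integrable_mul_exp_neg_mul_sq (by norm_num)
  have h1 : ∫ y in Set.Ioi x, y * exp (-(1 / 2) * y ^ 2) = exp (-(1 / 2) * x ^ 2) := by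
    rw [integral_Ioi_of_hasDerivAt_of_tendsto (f := fun y => -exp (-(1 / 2) * y ^ 2)) (m := 0)
      (by fun_prop) _ hint.integrableOn]
    · simp
    · rw [← neg_zero]
      refine (tendsto_exp_atBot.comp ?_).neg
      exact (tendsto_pow_atTop two_ne_zero).const_mul_atTop_of_neg (by norm_num)
    · intro y _
      refine (((hasDerivAt_pow 2 y).const_mul (-(1 / 2))).exp).neg.congr_deriv ?_
      push_cast
      ring
  rw [← h1, ← integral_const_mul]
  refine setIntegral_mono_on (integrable_exp_neg_half_sq.const_mul _).integrableOn
    hint.integrableOn measurableSet_Ioi fun t ht => ?_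
  have : x < t := ht
  gcongr

/-- Solution of Stein's equation `f' - x f = g` for a bounded continuous `g` that is centred
under the standard Gaussian. -/
lemma exists_stein_solution_of_centred {g : ℝ → ℝ} (hg : Continuous g) (hg1 : ∀ x, |g x| ≤ 1)
    (hg0 : ∫ y, g y * exp (-(1 / 2) * y ^ 2) = 0) :
    ∃ f : ℝ → ℝ, (∀ x, HasDerivAt f (x * f x + g x) x) ∧ (∀ x, |f x| ≤ √(π / 2)) ∧
      ∀ x, |x * f x + g x| ≤ 2 := by
  set k : ℝ → ℝ := fun y => g y * exp (-(1 / 2) * y ^ 2) with hk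
  have hkc : Continuous k := by fun_prop
  have hkle : ∀ y, ‖k y‖ ≤ exp (-(1 / 2) * y ^ 2) := fun y => by
    rw [hk, norm_mul, norm_of_nonneg (exp_pos _).le]
    exact mul_le_of_le_one_left (exp_pos _).le (hg1 y)
  have hki : Integrable k :=
    integrable_exp_neg_half_sq.mono' hkc.aestronglyMeasurable (ae_of_all _ hkle)
  set G : ℝ → ℝ := fun x => ∫ y in Set.Iic x, k y with hG
  have hGd : ∀ x, HasDerivAt G (k x) x := fun x => by
    have : G = fun x => G 0 + ∫ y in (0 : ℝ)..x, k y := by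
      ext x
      rw [← intervalIntegral.integral_Iic_sub_Iic hki.integrableOn hki.integrableOn]
      simp [hG]
    rw [this]
    exact (hkc.integral_hasStrictDerivAt 0 x).hasDerivAt.const_add _
  have hGabs : ∀ x, |G x| ≤ ∫ y in Set.Ioi |x|, exp (-(1 / 2) * y ^ 2) := fun x => by
    rcases le_total 0 x with hx | hx
    · have : G x = -∫ y in Set.Ioi x, k y := by
        rw [eq_neg_iff_add_eq_zero, hG]
        rw [intervalIntegral.integral_Iic_add_Ioi hki.integrableOn hki.integrableOn, hg0]
      rw [this, abs_neg, abs_of_nonneg hx]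
      exact norm_integral_le_of_norm_le integrable_exp_neg_half_sq.integrableOn
        (ae_of_all _ hkle)
    · rw [abs_of_nonpos hx, ← integral_comp_neg_Iic]
      simp only [neg_sq]
      exact norm_integral_le_of_norm_le integrable_exp_neg_half_sq.integrableOn
        (ae_of_all _ hkle)
  set f : ℝ → ℝ := fun x => exp (1 / 2 * x ^ 2) * G x with hf
  have hcancel : ∀ x : ℝ, exp (1 / 2 * x ^ 2) * exp (-(1 / 2) * x ^ 2) = 1 := fun x => by
    rw [← exp_add]; simp
  have hfabs : ∀ x, |f x| = exp (1 / 2 * x ^ 2) * |G x| := fun x => by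
    rw [hf, abs_mul, abs_of_pos (exp_pos _)]
  have hxf : ∀ x, |x * f x| ≤ 1 := fun x => by
    have := (mul_le_mul_of_nonneg_left (hGabs x) (abs_nonneg x)).trans
      (mul_integral_Ioi_exp_neg_half_sq_le |x|)
    rw [sq_abs] at this
    rw [abs_mul, hfabs, mul_left_comm]
    exact (mul_le_mul_of_nonneg_left this (exp_pos _).le).trans_eq (hcancel x)
  refine ⟨f, fun x => ?_, fun x => ?_, fun x => ?_⟩
  · refine ((((hasDerivAt_pow 2 x).const_mul (1 / 2)).exp).mul (hGd x)).congr_deriv ?_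
    simp only [hf, hk]
    push_cast
    linear_combination g x * hcancel x
  · rw [hfabs]
    have := (hGabs x).trans (integral_Ioi_exp_neg_half_sq_le (abs_nonneg x))
    rw [sq_abs] at this
    calc _ ≤ exp (1 / 2 * x ^ 2) * (exp (-(1 / 2) * x ^ 2) * √(π / 2)) := by gcongr
      _ = _ := by rw [← mul_assoc, hcancel, one_mul]
  · exact (abs_add_le _ _).trans (by linarith [hxf x, hg1 x])

/-- Stein's equation `σ² f' - x f = h - E h(σN)` with the uniform bounds for test functions
`h` with values in `[0, 1]`. -/
lemma exists_stein_solution {h : ℝ → ℝ} (hh : Continuous h) (h0 : ∀ x, 0 ≤ h x)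
    (h1 : ∀ x, h x ≤ 1) {σ : ℝ} (hσ : 0 < σ) :
    ∃ f f' : ℝ → ℝ, Continuous f' ∧ (∀ x, HasDerivAt f (f' x) x) ∧
      (∀ x, |f x| ≤ 1 / σ * √(π / 2)) ∧ (∀ x, |f' x| ≤ 2 / σ ^ 2) ∧
      ∀ x, σ ^ 2 * f' x - x * f x = h x - ∫ t, h (σ * t) ∂gaussianReal 0 1 := by
  set c := ∫ t, h (σ * t) ∂gaussianReal 0 1 with hc
  have hint : Integrable (fun t => h (σ * t)) (gaussianReal 0 1) :=
    Integrable.of_bound (by fun_prop : Continuous fun t => h (σ * t)).aestronglyMeasurable 1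
      (ae_of_all _ fun t => by rw [norm_of_nonneg (h0 _)]; exact h1 _)
  have hc0 : 0 ≤ c := integral_nonneg fun t => h0 _
  have hc1 : c ≤ 1 := by
    simpa using integral_mono hint (integrable_const 1) fun t => h1 (σ * t)
  have hcent : ∫ y, (h (σ * y) - c) * exp (-(1 / 2) * y ^ 2) = 0 := by
    have h2 : ∫ t, (h (σ * t) - c) ∂gaussianReal 0 1 = 0 := by
      rw [integral_sub hint (integrable_const c)]
      simp [hc]
    rw [integral_gaussianReal_eq_integral_smul one_ne_zero] at h2
    simp only [gaussianPDFReal, smul_eq_mul, mul_assoc, integral_const_mul] at h2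
    have h3 := (mul_eq_zero.1 h2).resolve_left (by positivity)
    rw [← h3]
    congr 1 with y
    rw [mul_comm]
    congr 2
    simp; ring
  obtain ⟨f, hf, hfb, hfb'⟩ := exists_stein_solution_of_centred
    (g := fun y => h (σ * y) - c) (by fun_prop)
    (fun x => abs_le.2 ⟨by linarith [h0 (σ * x)], by linarith [h1 (σ * x)]⟩) hcent
  have hfc : Continuous f := continuous_iff_continuousAt.2 fun x => (hf x).continuousAt
  refine ⟨fun x => 1 / σ * f (x / σ),
    fun x => 1 / σ ^ 2 * (x / σ * f (x / σ) + (h (σ * (x / σ)) - c)), by fun_prop,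
    fun x => ?_, fun x => ?_, fun x => ?_, fun x => ?_⟩
  · refine (((hf (x / σ)).comp x ((hasDerivAt_id x).div_const σ)).const_mul
      (1 / σ)).congr_deriv ?_
    ring
  · rw [abs_mul, abs_of_pos (by positivity)]
    gcongr
    exact hfb _
  · rw [abs_mul, abs_of_pos (by positivity)]
    calc _ ≤ 1 / σ ^ 2 * 2 := by gcongr; exact hfb' _
      _ = _ := by ring
  · have hx : σ * (x / σ) = x := by field_simp
    simp only [hx]
    field_simp
    ring

lemma tvDist_le_of_forall_continuous {μ ν : Measure ℝ} [IsProbabilityMeasure μ]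
    [IsProbabilityMeasure ν] {C : ℝ}
    (H : ∀ h : ℝ → ℝ, Continuous h → (∀ x, 0 ≤ h x) → (∀ x, h x ≤ 1) →
      ∫ x, h x ∂μ - ∫ x, h x ∂ν ≤ C) :
    tvDist μ ν ≤ C := by
  have hclosed : ∀ K : Set ℝ, IsClosed K → μ.real K - ν.real K ≤ C := fun K hK => by
    have hpos : ∀ n : ℕ, (0 : ℝ) < 1 / ((n : ℝ) + 1) := fun n => by positivity
    have hlim := tendsto_one_div_add_atTop_nhds_zero_nat (𝕜 := ℝ)
    refine le_of_tendsto ((tendsto_integral_thickenedIndicator_of_isClosed μ hK hpos hlim).sub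
      (tendsto_integral_thickenedIndicator_of_isClosed ν hK hpos hlim))
      (Eventually.of_forall fun n => H _ ?_ ?_ ?_)
    · exact NNReal.continuous_coe.comp (thickenedIndicator (hpos n) K).continuous
    · exact fun x => NNReal.coe_nonneg _
    · exact fun x => mod_cast thickenedIndicator_le_one (hpos n) K x
  refine csSup_le ⟨_, ∅, MeasurableSet.empty, rfl⟩ ?_
  rintro r ⟨B, hB, rfl⟩
  refine le_of_forall_pos_le_add fun ε hε => ?_
  obtain ⟨K, hKB, hK, hlt⟩ := hB.exists_isClosed_lt_add (measure_ne_top μ B)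
    (ε := ENNReal.ofReal ε) (by simpa using hε)
  have h1 : (μ B).toReal ≤ μ.real K + ε := by
    have := ENNReal.toReal_mono (by finiteness) hlt.le
    rwa [ENNReal.toReal_add (by finiteness) (by finiteness), ENNReal.toReal_ofReal hε.le] at this
  have h2 : ν.real K ≤ (ν B).toReal := measureReal_mono hKB
  linarith [hclosed K hK]

lemma pd_eq_fderiv {n : ℕ} {F : (Fin n → ℝ) → ℝ} (hF : Differentiable ℝ F) (i : Fin n) :
    pd i F = fun x => fderiv ℝ F x (Pi.single i 1) := by
  ext x
  have h : HasFDerivAt F (fderiv ℝ F x) (Function.update x i (x i)) := by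
    rw [Function.update_eq_self]; exact (hF x).hasFDerivAt
  exact (h.comp_hasDerivAt (x i) (hasDerivAt_update x i (x i))).deriv

lemma contDiff_pd {n : ℕ} {F : (Fin n → ℝ) → ℝ} {k m : WithTop ℕ∞} (hF : ContDiff ℝ m F)
    (hkm : k + 1 ≤ m) (i : Fin n) : ContDiff ℝ k (pd i F) := by
  rw [pd_eq_fderiv (hF.differentiable (ne_of_gt (lt_of_lt_of_le (by simp) hkm)))]
  exact (hF.fderiv_right hkm).clm_apply contDiff_const

lemma hasCompactSupport_pd {n : ℕ} {F : (Fin n → ℝ) → ℝ} (hF : Differentiable ℝ F)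
    (hs : HasCompactSupport F) (i : Fin n) : HasCompactSupport (pd i F) := by
  rw [pd_eq_fderiv hF]
  exact hs.fderiv_apply ℝ _

lemma pd_mul {n : ℕ} {F G : (Fin n → ℝ) → ℝ} (hF : Differentiable ℝ F)
    (hG : Differentiable ℝ G) (i : Fin n) (x : Fin n → ℝ) :
    pd i (fun y => F y * G y) x = F x * pd i G x + pd i F x * G x := by
  rw [pd_eq_fderiv hF, pd_eq_fderiv hG, pd_eq_fderiv (hF.fun_mul hG)]
  simp [fderiv_fun_mul (hF x) (hG x), mul_comm]

lemma pd_comp {n : ℕ} {G : (Fin n → ℝ) → ℝ} {φ φ' : ℝ → ℝ} (hG : Differentiable ℝ G)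
    (hφ : ∀ t, HasDerivAt φ (φ' t) t) (i : Fin n) (x : Fin n → ℝ) :
    pd i (fun y => φ (G y)) x = φ' (G x) * pd i G x := by
  have h : ∀ y, HasFDerivAt (fun y => φ (G y)) (φ' (G y) • fderiv ℝ G y) y := fun y =>
    (hφ (G y)).comp_hasFDerivAt y (hG y).hasFDerivAt
  rw [pd_eq_fderiv hG, pd_eq_fderiv fun y => (h y).differentiableAt]
  simp [(h x).fderiv]

lemma integral_mul_pd_eq_neg {n : ℕ} {F G : (Fin n → ℝ) → ℝ} (hF : ContDiff ℝ 1 F)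
    (hs : HasCompactSupport F) (hG : ContDiff ℝ 1 G) (i : Fin n) :
    ∫ x, F x * pd i G x = -∫ x, pd i F x * G x := by
  have hFd := hF.differentiable one_ne_zero
  have hGd := hG.differentiable one_ne_zero
  have hpF := (contDiff_pd hF (k := 0) (by simp) i).continuous
  have hpG := (contDiff_pd hG (k := 0) (by simp) i).continuous
  have hpFs := hasCompactSupport_pd hFd hs i
  have h1 := (hpF.mul hG.continuous).integrable_of_hasCompactSupport (μ := volume) hpFs.mul_right
  have h2 := (hF.continuous.mul hpG).integrable_of_hasCompactSupport (μ := volume) hs.mul_right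
  have h3 := (hF.continuous.mul hG.continuous).integrable_of_hasCompactSupport (μ := volume)
    hs.mul_right
  simp only [pd_eq_fderiv hFd, pd_eq_fderiv hGd] at h1 h2 ⊢
  exact integral_mul_fderiv_eq_neg_fderiv_mul_of_integrable h1 h2 h3 (fun x _ => hFd x)
    fun x _ => hGd x

section Gibbs

variable {n : ℕ} {W : (Fin n → ℝ) → ℝ}

lemma gibbsZ_pos (hZ0 : Integrable fun x : Fin n → ℝ => exp (-W x)) : 0 < gibbsZ W :=
  integral_exp_pos hZ0

lemma isProbabilityMeasure_gibbsP (hZ0 : Integrable fun x : Fin n → ℝ => exp (-W x)) :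
    IsProbabilityMeasure (gibbsP W) := by
  refine ⟨?_⟩
  rw [gibbsP, withDensity_apply _ MeasurableSet.univ, Measure.restrict_univ,
    ← ofReal_integral_eq_lintegral_ofReal (hZ0.div_const _)
      (ae_of_all _ fun x => div_nonneg (exp_pos _).le (gibbsZ_pos hZ0).le),
    integral_div, ← gibbsZ, div_self (gibbsZ_pos hZ0).ne', ENNReal.ofReal_one]

lemma integral_gibbsP (hW : Continuous W) (hZ0 : Integrable fun x : Fin n → ℝ => exp (-W x))
    (g : (Fin n → ℝ) → ℝ) :
    ∫ x, g x ∂gibbsP W = (∫ x, g x * exp (-W x)) / gibbsZ W := by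
  rw [gibbsP, integral_withDensity_eq_integral_toReal_smul (by fun_prop)
    (ae_of_all _ fun x => ENNReal.ofReal_lt_top), ← integral_div]
  congr 1 with x
  rw [ENNReal.toReal_ofReal (div_nonneg (exp_pos _).le (gibbsZ_pos hZ0).le), smul_eq_mul]
  ring

lemma contDiff_genL (hW : ContDiff ℝ 2 W) {F : (Fin n → ℝ) → ℝ} (hF : ContDiff ℝ 3 F) :
    ContDiff ℝ 1 (genL W F) := by
  have h1 := contDiff_pd hW (k := 1) (by norm_num)
  have h2 := contDiff_pd hF (k := 2) (by norm_num)
  have h3 := fun i => contDiff_pd (h2 i) (k := 1) (by norm_num) i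
  unfold genL cdc
  exact (ContDiff.sum fun i _ => h3 i).sub
    (ContDiff.sum fun i _ => (h1 i).mul ((h2 i).of_le (by norm_num)))

lemma HasCompactSupport.sum_fun {ι α : Type*} [TopologicalSpace α] (s : Finset ι)
    {f : ι → α → ℝ} (hf : ∀ i, HasCompactSupport (f i)) :
    HasCompactSupport fun x => ∑ i ∈ s, f i x := by
  classical
  induction s using Finset.induction_on with
  | empty => exact HasCompactSupport.zero
  | insert a s ha ih =>
    simp only [Finset.sum_insert ha]
    exact (hf a).add ih

lemma hasCompactSupport_cdc {F G : (Fin n → ℝ) → ℝ} (hF : Differentiable ℝ F)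
    (hs : HasCompactSupport F) : HasCompactSupport (cdc G F) :=
  HasCompactSupport.sum_fun _ fun i => (hasCompactSupport_pd hF hs i).mul_left

lemma continuous_cdc {F G : (Fin n → ℝ) → ℝ} (hF : ContDiff ℝ 1 F) (hG : ContDiff ℝ 1 G) :
    Continuous (cdc F G) :=
  continuous_finsetSum _ fun i _ =>
    (contDiff_pd hF (k := 0) (by simp) i).continuous.mul
      (contDiff_pd hG (k := 0) (by simp) i).continuous

lemma hasCompactSupport_genL {F : (Fin n → ℝ) → ℝ} (hF : ContDiff ℝ 2 F)
    (hs : HasCompactSupport F) : HasCompactSupport (genL W F) := by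
  have hFd := hF.differentiable two_ne_zero
  refine HasCompactSupport.sub (HasCompactSupport.sum_fun _ fun i => ?_)
    (hasCompactSupport_cdc hFd hs)
  exact hasCompactSupport_pd ((contDiff_pd hF (k := 1) (by norm_num) i).differentiable one_ne_zero)
    (hasCompactSupport_pd hFd hs i) i

/-- Integration by parts for the Gibbs measure: `E[Γ[G, F]] = -E[(L F) G]`. -/
lemma integral_cdc_gibbsP (hW : ContDiff ℝ 2 W)
    (hZ0 : Integrable fun x : Fin n → ℝ => exp (-W x)) {F G : (Fin n → ℝ) → ℝ}
    (hF : ContDiff ℝ 2 F) (hs : HasCompactSupport F) (hG : ContDiff ℝ 1 G) :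
    ∫ x, cdc G F x ∂gibbsP W = -∫ x, genL W F x * G x ∂gibbsP W := by
  have hW1 : ContDiff ℝ 1 W := hW.of_le (by norm_num)
  have hFd := hF.differentiable two_ne_zero
  have hexp : ContDiff ℝ 1 fun x => exp (-W x) := hW1.neg.exp
  have hpF := contDiff_pd hF (k := 1) (by norm_num)
  have hpFs := hasCompactSupport_pd hFd hs
  have hk : ∀ i, ContDiff ℝ 1 fun x => pd i F x * exp (-W x) := fun i => (hpF i).mul hexp
  have hks : ∀ i, HasCompactSupport fun x => pd i F x * exp (-W x) := fun i => (hpFs i).mul_right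
  have hpe : ∀ i x, pd i (fun y => exp (-W y)) x = -(pd i W x * exp (-W x)) := fun i x => by
    rw [pd_comp (φ := fun t => exp (-t)) (φ' := fun t => -exp (-t))
      (hW1.differentiable one_ne_zero) fun t => by simpa using (hasDerivAt_neg t).exp]
    ring
  have hpk : ∀ i x, pd i (fun y => pd i F y * exp (-W y)) x
      = (pd i (pd i F) x - pd i W x * pd i F x) * exp (-W x) := fun i x => by
    rw [pd_mul ((hpF i).differentiable one_ne_zero) (hexp.differentiable one_ne_zero), hpe]
    ring
  have hi1 : ∀ i, Integrable fun x => pd i F x * exp (-W x) * pd i G x := fun i =>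
    ((hk i).continuous.mul (contDiff_pd hG (k := 0) (by simp) i).continuous
      ).integrable_of_hasCompactSupport (hks i).mul_right
  have hi2 : ∀ i, Integrable fun x => pd i (fun y => pd i F y * exp (-W y)) x * G x := fun i =>
    ((contDiff_pd (hk i) (k := 0) (by simp) i).continuous.mul hG.continuous
      ).integrable_of_hasCompactSupport
      (hasCompactSupport_pd ((hk i).differentiable one_ne_zero) (hks i) i).mul_right
  rw [integral_gibbsP hW.continuous hZ0, integral_gibbsP hW.continuous hZ0, ← neg_div]
  congr 1
  calc ∫ x, cdc G F x * exp (-W x)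
      = ∫ x, ∑ i, pd i F x * exp (-W x) * pd i G x := by
        congr 1 with x
        rw [cdc, Finset.sum_mul]
        exact Finset.sum_congr rfl fun i _ => by ring
    _ = -∫ x, ∑ i, pd i (fun y => pd i F y * exp (-W y)) x * G x := by
        rw [integral_finsetSum _ fun i _ => hi1 i, integral_finsetSum _ fun i _ => hi2 i,
          ← Finset.sum_neg_distrib]
        exact Finset.sum_congr rfl fun i _ => integral_mul_pd_eq_neg (hk i) (hks i) hG i
    _ = -∫ x, genL W F x * G x * exp (-W x) := by
        congr 2 with x
        simp only [hpk]
        rw [genL, cdc, ← Finset.sum_sub_distrib, Finset.sum_mul, Finset.sum_mul]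
        exact Finset.sum_congr rfl fun i _ => by ring

end Gibbs

/-- abstract Stein bound in total variation for real random
variables of the form `X = L F + Z` under a Gibbs measure. -/
theorem statement7 (n : ℕ) (W : (Fin n → ℝ) → ℝ) (hW : ContDiff ℝ 2 W)
    (hZ0 : Integrable (fun x : Fin n → ℝ => Real.exp (-W x)))
    (F : (Fin n → ℝ) → ℝ) (hF : IsCcInfty F)
    (Z : (Fin n → ℝ) → ℝ) (hZreg : ContDiff ℝ 1 Z)
    (hZint : Integrable Z (gibbsP W))
    (σ : ℝ) (hσ : 0 < σ) :
    tvDist ((gibbsP W).map (fun x => genL W F x + Z x))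
        ((gaussianReal 0 1).map (fun t => σ * t)) ≤
      (2 / σ ^ 2) * (∫ x, |σ ^ 2 - (-cdc (fun y => genL W F y + Z y) F x)| ∂gibbsP W) +
        (1 / σ) * Real.sqrt (π / 2) * ∫ x, |Z x| ∂gibbsP W := by
  have := isProbabilityMeasure_gibbsP hZ0
  obtain ⟨hFsm, hs⟩ := hF
  have hF3 : ContDiff ℝ 3 F := contDiff_infty.1 hFsm 3
  have hF2 : ContDiff ℝ 2 F := hF3.of_le (by norm_num)
  have hL : ContDiff ℝ 1 (genL W F) := contDiff_genL hW hF3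
  have hLs : HasCompactSupport (genL W F) := hasCompactSupport_genL hF2 hs
  set X : (Fin n → ℝ) → ℝ := fun x => genL W F x + Z x with hX
  have hXc : ContDiff ℝ 1 X := hL.add hZreg
  have hXm : Measurable X := hXc.continuous.measurable
  have hσm : Measurable fun t : ℝ => σ * t := by fun_prop
  have := Measure.isProbabilityMeasure_map (μ := gibbsP W) hXm.aemeasurable
  have := Measure.isProbabilityMeasure_map (μ := gaussianReal 0 1) hσm.aemeasurable
  refine tvDist_le_of_forall_continuous fun h hh h0 h1 => ?_
  obtain ⟨f, f', hf'c, hf, hfb, hf'b, hstein⟩ := exists_stein_solution hh h0 h1 hσ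
  set c := ∫ t, h (σ * t) ∂gaussianReal 0 1
  rw [integral_map hXm.aemeasurable hh.aestronglyMeasurable,
    integral_map hσm.aemeasurable hh.aestronglyMeasurable]
  have hfC : ContDiff ℝ 1 f := by
    rw [contDiff_one_iff_deriv]
    exact ⟨fun x => (hf x).differentiableAt, by rwa [funext fun x => (hf x).deriv]⟩
  have hfX : ContDiff ℝ 1 fun x => f (X x) := hfC.comp hXc
  have hchain : ∀ x, cdc (fun y => f (X y)) F x = f' (X x) * cdc X F x := fun x => by
    simp only [cdc, pd_comp (hXc.differentiable one_ne_zero) hf, Finset.mul_sum, mul_assoc]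
  have hibp := integral_cdc_gibbsP hW hZ0 hF2 hs hfX
  simp only [hchain] at hibp
  have hcont := continuous_cdc hXc (hF2.of_le (by norm_num))
  have hcdc : Integrable (cdc X F) (gibbsP W) := by
    obtain ⟨C, hC⟩ := hcont.bounded_above_of_compact_support
      (hasCompactSupport_cdc (G := X) (hF2.differentiable two_ne_zero) hs)
    exact Integrable.of_bound hcont.aestronglyMeasurable C (ae_of_all _ hC)
  have hLi : Integrable (genL W F) (gibbsP W) := by
    obtain ⟨C, hC⟩ := hL.continuous.bounded_above_of_compact_support hLs
    exact Integrable.of_bound hL.continuous.aestronglyMeasurable C (ae_of_all _ hC)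
  have hf'X : Continuous fun x => f' (X x) := hf'c.comp hXc.continuous
  have hbf : ∀ {g : (Fin n → ℝ) → ℝ}, Integrable g (gibbsP W) →
      Integrable (fun x => g x * f (X x)) (gibbsP W) := fun hg =>
    hg.mul_bdd hfX.continuous.aestronglyMeasurable (ae_of_all _ fun x => hfb (X x))
  have hbf' : ∀ {g : (Fin n → ℝ) → ℝ}, Integrable g (gibbsP W) →
      Integrable (fun x => f' (X x) * g x) (gibbsP W) := fun hg =>
    hg.bdd_mul hf'X.aestronglyMeasurable (ae_of_all _ fun x => hf'b (X x))
  have hhX : Integrable (fun x => h (X x)) (gibbsP W) :=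
    Integrable.of_bound (hh.comp hXc.continuous).aestronglyMeasurable 1
      (ae_of_all _ fun x => by rw [norm_of_nonneg (h0 _)]; exact h1 _)
  have hΓ : Integrable (fun x => σ ^ 2 - (-cdc X F x)) (gibbsP W) :=
    (integrable_const _).sub hcdc.neg
  have hkey : ∫ x, h (X x) ∂gibbsP W - c
      = ∫ x, f' (X x) * (σ ^ 2 - (-cdc X F x)) ∂gibbsP W - ∫ x, Z x * f (X x) ∂gibbsP W := by
    have e1 : ∫ x, f' (X x) * (σ ^ 2 - (-cdc X F x)) ∂gibbsP W
        = ∫ x, f' (X x) * σ ^ 2 ∂gibbsP W + ∫ x, f' (X x) * cdc X F x ∂gibbsP W := by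
      rw [← integral_add (hbf' (integrable_const _)) (hbf' hcdc)]
      congr 1 with x
      ring
    have e2 : ∫ x, h (X x) ∂gibbsP W - c = ∫ x, (h (X x) - c) ∂gibbsP W := by
      rw [integral_sub hhX (integrable_const _)]
      simp
    rw [e1, hibp, e2, ← sub_eq_add_neg, ← integral_sub (hbf' (integrable_const _)) (hbf hLi),
      ← integral_sub (by exact (hbf' (integrable_const _)).sub (hbf hLi)) (hbf hZint)]
    congr 1 with x
    rw [← hstein]
    simp only [hX]
    ring
  have hb1 : ∫ x, f' (X x) * (σ ^ 2 - (-cdc X F x)) ∂gibbsP W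
      ≤ 2 / σ ^ 2 * ∫ x, |σ ^ 2 - (-cdc X F x)| ∂gibbsP W := by
    rw [← integral_const_mul]
    refine integral_mono (hbf' hΓ) (hΓ.abs.const_mul _) fun x => ?_
    refine (le_abs_self _).trans ?_
    rw [abs_mul]
    exact mul_le_mul_of_nonneg_right (hf'b _) (abs_nonneg _)
  have hb2 : -∫ x, Z x * f (X x) ∂gibbsP W
      ≤ 1 / σ * √(π / 2) * ∫ x, |Z x| ∂gibbsP W := by
    rw [← integral_const_mul, ← integral_neg]
    refine integral_mono (hbf hZint).neg (hZint.abs.const_mul _) fun x => ?_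
    refine (neg_le_abs _).trans ?_
    rw [abs_mul, mul_comm]
    exact mul_le_mul_of_nonneg_right (hfb _) (abs_nonneg _)
  linarith
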